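/- Fix β > 0 and define g(ρ) = (√((β+ρ−1)² + 4ρ) − (β+ρ−1)) / (2ρ) and the alternative regularization parameter u(ρ) = g(ρ)/(1+g(ρ)) for ρ > 0. Then: (i) u is strictly decreasing on (0,∞); (ii) u(ρ) tends to 0 as ρ → ∞; and (iii) if moreover β ≤ 1, then u(ρ) tends to 1 as ρ → 0 from the right. -/

import Mathlib

/-- The positive root `g` of `ρ g² + (β + ρ - 1) g = 1`, transformed to `u = g / (1 + g)`, lies in
`(0, 1)` and satisfies `ρ u = (1 - u) (1 - β u)`. -/
lemma regularization_spec {β ρ g u : ℝ} (hρ : 0 < ρ)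
    (hg : g = (Real.sqrt ((β + ρ - 1) ^ 2 + 4 * ρ) - (β + ρ - 1)) / (2 * ρ))
    (hu : u = g / (1 + g)) :
    0 < u ∧ u < 1 ∧ ρ * u = (1 - u) * (1 - β * u) := by
  set s := Real.sqrt ((β + ρ - 1) ^ 2 + 4 * ρ) with hs
  have hs_sq : s ^ 2 = (β + ρ - 1) ^ 2 + 4 * ρ := Real.sq_sqrt (by positivity)
  have hs_gt : β + ρ - 1 < s := Real.lt_sqrt_of_sq_lt (by linarith)
  have hg_pos : 0 < g := hg ▸ div_pos (sub_pos.2 hs_gt) (by positivity)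
  have hsg : s = 2 * ρ * g + (β + ρ - 1) := by rw [hg]; field_simp; ring
  have hquad : ρ * g ^ 2 + (β + ρ - 1) * g - 1 = 0 := by
    rw [hsg] at hs_sq
    have h : 4 * ρ * (ρ * g ^ 2 + (β + ρ - 1) * g - 1) = 0 := by linear_combination hs_sq
    exact (mul_eq_zero.1 h).resolve_left (by positivity)
  refine ⟨hu ▸ by positivity, hu ▸ (div_lt_one (by positivity)).2 (by linarith), ?_⟩
  rw [hu]
  field_simp
  linear_combination hquad

/-- For fixed `β > 0`, with `g(ρ) = (√((β+ρ−1)² + 4ρ) − (β+ρ−1))/(2ρ)` and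
`u(ρ) = g(ρ)/(1+g(ρ))`: (i) `u` is strictly decreasing on `(0,∞)`;
(ii) `u(ρ) → 0` as `ρ → ∞`; (iii) if `β ≤ 1` then `u(ρ) → 1` as `ρ → 0⁺`. -/
theorem stmt4 (β : ℝ) (hβ : 0 < β)
    (g u : ℝ → ℝ)
    (hg : ∀ ρ, g ρ = (Real.sqrt ((β + ρ - 1) ^ 2 + 4 * ρ) - (β + ρ - 1)) / (2 * ρ))
    (hu : ∀ ρ, u ρ = g ρ / (1 + g ρ)) :
    StrictAntiOn u (Set.Ioi 0) ∧
    Filter.Tendsto u Filter.atTop (nhds 0) ∧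
    (β ≤ 1 → Filter.Tendsto u (nhdsWithin 0 (Set.Ioi 0)) (nhds 1)) := by
  have hspec : ∀ ρ, 0 < ρ → 0 < u ρ ∧ u ρ < 1 ∧ ρ * u ρ = (1 - u ρ) * (1 - β * u ρ) :=
    fun ρ hρ => regularization_spec hρ (hg ρ) (hu ρ)
  refine ⟨?_, ?_, fun hβ1 => ?_⟩
  · intro a ha b hb hab
    obtain ⟨ha0, ha1, hae⟩ := hspec a ha
    obtain ⟨hb0, hb1, hbe⟩ := hspec b hb
    by_contra! hle
    have hlt : a * u a < b * u b := mul_lt_mul hab hle ha0 (le_of_lt hb)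
    have hβu : 0 < 1 - β * u b :=
      pos_of_mul_pos_right (hbe ▸ mul_pos hb hb0) (sub_pos.2 hb1).le
    have hanti : (1 - u b) * (1 - β * u b) ≤ (1 - u a) * (1 - β * u a) := by gcongr
    linarith
  · refine tendsto_of_tendsto_of_tendsto_of_le_of_le' tendsto_const_nhds tendsto_inv_atTop_zero
      ?_ ?_ <;> filter_upwards [Filter.eventually_gt_atTop 0] with ρ hρ
    · exact (hspec ρ hρ).1.le
    · obtain ⟨h0, h1, he⟩ := hspec ρ hρ
      rw [← one_div, le_div_iff₀ hρ]
      nlinarith [mul_pos (mul_pos hβ h0) (sub_pos.2 h1)]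
  · have hlim : Filter.Tendsto (fun ρ => 1 - Real.sqrt ρ) (nhdsWithin 0 (Set.Ioi 0)) (nhds 1) := by
      have hc : Continuous fun ρ => 1 - Real.sqrt ρ := by fun_prop
      simpa using (hc.tendsto 0).mono_left nhdsWithin_le_nhds
    refine tendsto_of_tendsto_of_tendsto_of_le_of_le' hlim tendsto_const_nhds
      ?_ ?_ <;> filter_upwards [self_mem_nhdsWithin] with ρ hρ
    · obtain ⟨h0, h1, he⟩ := hspec ρ hρ
      have hρ' : 0 < ρ := hρ
      have hsq : 1 - u ρ ≤ Real.sqrt ρ := by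
        apply Real.le_sqrt_of_sq_le
        nlinarith [mul_nonneg (mul_nonneg (sub_nonneg.2 hβ1) h0.le) (sub_pos.2 h1).le,
          mul_pos hρ' (sub_pos.2 h1)]
      linarith
    · exact (hspec ρ hρ).2.1.le
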